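/- Let D be the dictionary of a VFR universal in P_k (so that M divides |D(T)| for every type class T), and let D* be the greedy optimal dictionary. Then for every N ≥ 0 and every P ∈ P_k: P(fail*_N) ≤ P(fail_N) and L_P^M(D*_N) ≤ L_P^M(D_N). Moreover, if |D(T)| ≠ |D*(T)| for some n and some T ∈ T_n, then L_P^M(D*_N) < L_P^M(D_N) for all N > n and all P ∈ P_k. -/

import Mathlib

open Finset

/-- `Finset.filter` with classical decidability. -/
noncomputable def sfilter {α : Type*} (p : α → Prop) (s : Finset α) : Finset α :=
  @Finset.filter α p (Classical.decPred p) s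

/-- The finset of all strings of length `n` over the alphabet `A`. -/
def lists (A : Type*) [Fintype A] [DecidableEq A] : ℕ → Finset (List A)
  | 0 => {[]}
  | n + 1 => Finset.image₂ List.cons Finset.univ (lists A n)

/-- Symbol at (0-indexed) integer position `j` of the string `x`, where negative
positions `-k, …, -1` are given by the fixed initial state `s0`. -/
def symL {A : Type*} [Inhabited A] (k : ℕ) (s0 : Fin k → A) (x : List A) (j : ℤ) : A :=
  if h : 0 ≤ j then
    (if h2 : j.toNat < x.length then x.get ⟨j.toNat, h2⟩ else default)
  else
    (if h3 : (j + k).toNat < k then s0 ⟨(j + k).toNat, h3⟩ else default)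

/-- The state (context of order `k`) preceding position `t` of the string `x`. -/
def ctxL {A : Type*} [Inhabited A] (k : ℕ) (s0 : Fin k → A) (x : List A)
    (t : ℕ) : Fin k → A :=
  fun i => symL k s0 x ((t : ℤ) - (k : ℤ) + (i : ℤ))

/-- `n_{sa}(x)`: number of occurrences of symbol `a` in state `s` within `x`. -/
noncomputable def countL {A : Type*} [Inhabited A] [DecidableEq A] (k : ℕ)
    (s0 : Fin k → A) (s : Fin k → A) (a : A) (x : List A) : ℕ :=
  (sfilter (fun t : Fin x.length => ctxL k s0 x t = s ∧ x.get t = a) Finset.univ).card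

/-- Two strings have the same `k`-th order type. -/
def sameTypeL {A : Type*} [Inhabited A] [DecidableEq A] (k : ℕ) (s0 : Fin k → A)
    (x y : List A) : Prop :=
  x.length = y.length ∧
    ∀ (s : Fin k → A) (a : A), countL k s0 s a x = countL k s0 s a y

/-- The type class `T(x)` as a finset of strings of length `|x|`. -/
noncomputable def typeClassL {A : Type*} [Fintype A] [DecidableEq A] [Inhabited A]
    (k : ℕ) (s0 : Fin k → A) (x : List A) : Finset (List A) :=
  sfilter (fun y => sameTypeL k s0 x y) (lists A x.length)

/-- Probability `P(x) = ∏_t p(x_t | state)` of the string `x`. -/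
noncomputable def seqProbL {A : Type*} [Inhabited A] (k : ℕ) (s0 : Fin k → A)
    (p : (Fin k → A) → A → ℝ) (x : List A) : ℝ :=
  ∏ t : Fin x.length, p (ctxL k s0 x t) (x.get t)

/-- `p` is a (strictly positive) `k`-th order Markov kernel. -/
def IsMarkov {A : Type*} [Fintype A] (k : ℕ) (p : (Fin k → A) → A → ℝ) : Prop :=
  (∀ s a, 0 < p s a) ∧ ∀ s, ∑ a : A, p s a = 1

/-- A prefix-free set of strings. -/
def PrefixFree {A : Type*} (D : Set (List A)) : Prop :=
  ∀ x ∈ D, ∀ y ∈ D, x <+: y → x = y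

/-- A complete dictionary: prefix-free, and every string either has a prefix in `D`
or is a prefix of a string in `D`. -/
def CompleteDict {A : Type*} (D : Set (List A)) : Prop :=
  PrefixFree D ∧ ∀ z : List A, (∃ x ∈ D, x <+: z) ∨ (∃ y ∈ D, z <+: y)

/-- `D ∩ A^n` as a finset. -/
noncomputable def dictAt {A : Type*} [Fintype A] [DecidableEq A]
    (D : Set (List A)) (n : ℕ) : Finset (List A) :=
  sfilter (fun x => x ∈ D) (lists A n)

/-- The failure set at level `n`: strings of length `n` with no prefix in `D`. -/
noncomputable def failAt {A : Type*} [Fintype A] [DecidableEq A]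
    (D : Set (List A)) (n : ℕ) : Finset (List A) :=
  sfilter (fun x => ¬ ∃ y ∈ D, y <+: x) (lists A n)

/-- The failure part of a finite set `T` of strings: members with no prefix in `D`. -/
noncomputable def failIn {A : Type*} (D : Set (List A)) (T : Finset (List A)) :
    Finset (List A) :=
  sfilter (fun x => ¬ ∃ y ∈ D, y <+: x) T

/-- The VFR `(D, ξ, M)` is perfect for the process `p` (at every level `n`,
equivalently at every truncation level): conditioned on `X^n ∈ D ∩ A^n`
(whenever nonempty), `ξ(X^n)` is uniform on `{0, …, M−1}`. -/
def PerfectVFR {A : Type*} [Fintype A] [DecidableEq A] [Inhabited A] (k : ℕ)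
    (s0 : Fin k → A) (p : (Fin k → A) → A → ℝ) (D : Set (List A))
    (ξ : List A → ℕ) (M : ℕ) : Prop :=
  ∀ n : ℕ, (dictAt (A := A) D n).Nonempty →
    ∀ r < M,
      (∑ x ∈ sfilter (fun x => ξ x = r) (dictAt (A := A) D n), seqProbL k s0 p x)
        = (∑ x ∈ dictAt (A := A) D n, seqProbL k s0 p x) / (M : ℝ)

/-- Failure probability at truncation level `N`. -/
noncomputable def pFail {A : Type*} [Fintype A] [DecidableEq A] [Inhabited A] (k : ℕ)
    (s0 : Fin k → A) (p : (Fin k → A) → A → ℝ) (D : Set (List A)) (N : ℕ) : ℝ :=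
  ∑ x ∈ failAt (A := A) D N, seqProbL k s0 p x

/-- Expected input length of the truncation at level `N`:
`L_P^M(D_N) = Σ_{n=1}^N Σ_{x ∈ D ∩ A^n} n·P(x) + N·P(fail_N)`. -/
noncomputable def inLen {A : Type*} [Fintype A] [DecidableEq A] [Inhabited A] (k : ℕ)
    (s0 : Fin k → A) (p : (Fin k → A) → A → ℝ) (D : Set (List A)) (N : ℕ) : ℝ :=
  (∑ n ∈ Finset.Icc 1 N, ∑ x ∈ dictAt (A := A) D n, (n : ℝ) * seqProbL k s0 p x)
    + (N : ℝ) * pFail k s0 p D N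

open Equiv.Perm in
/-- Composing with a transposition that exchanges a point of the cycle of `s` with the
predecessor of a point `t` outside of it merges the two cycles. -/
theorem sameCycle_mul_swap {S : Type*} [Fintype S] [DecidableEq S] {σ : Equiv.Perm S}
    {s t : S} (ht : ¬ σ.SameCycle s t) {u : S} (hu : σ.SameCycle s u ∨ u = t) :
    (σ * Equiv.swap s (σ⁻¹ t)).SameCycle s u := by
  set τ := σ * Equiv.swap s (σ⁻¹ t) with hτ
  have hpred : ¬ σ.SameCycle s (σ⁻¹ t) := by simpa using ht
  have hτs : τ s = t := by simp [hτ]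
  have hτp : τ (σ⁻¹ t) = σ s := by simp [hτ]
  have hτv : ∀ v, v ≠ s → v ≠ σ⁻¹ t → τ v = σ v := by
    intro v h1 h2
    rw [hτ, Equiv.Perm.mul_apply, Equiv.swap_apply_of_ne_of_ne h1 h2]
  have hstep : ∀ v, τ.SameCycle s v → τ.SameCycle s (τ v) := fun v hv =>
    sameCycle_apply_right.2 hv
  have htQ : τ.SameCycle s t := hτs ▸ hstep s (SameCycle.refl _ _)
  have hforward : ∀ i : ℕ, τ.SameCycle s ((σ ^ i) t) ∨ τ.SameCycle s (σ⁻¹ t) := by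
    intro i
    induction i with
    | zero => left; simpa using htQ
    | succ i ih =>
      rcases ih with h | h
      · by_cases hv : (σ ^ i) t = σ⁻¹ t
        · right; rwa [hv] at h
        · left
          have hne : (σ ^ i) t ≠ s := by
            intro h'
            apply ht
            rw [← h']
            exact (sameCycle_pow_left.2 (SameCycle.refl _ _))
          have := hstep _ h
          rwa [hτv _ hne hv, ← Equiv.Perm.mul_apply, ← pow_succ'] at this
      · exact Or.inr h
  have hpQ : τ.SameCycle s (σ⁻¹ t) := by
    have hsc : σ.SameCycle t (σ⁻¹ t) := by simp [SameCycle.refl]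
    obtain ⟨i, hi⟩ := hsc.exists_nat_pow_eq
    rcases hforward i with h | h
    · rwa [hi] at h
    · exact h
  have hσs : τ.SameCycle s (σ s) := hτp ▸ hstep _ hpQ
  rcases hu with hu | rfl
  · have : ∀ i : ℕ, τ.SameCycle s ((σ ^ i) s) := by
      intro i
      induction i with
      | zero => simp [SameCycle.refl]
      | succ i ih =>
        rw [pow_succ', Equiv.Perm.mul_apply]
        by_cases hv : (σ ^ i) s = s
        · rwa [hv]
        · have hne : (σ ^ i) s ≠ σ⁻¹ t := by
            intro h'
            apply hpred
            rw [← h']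
            exact sameCycle_pow_right.2 (SameCycle.refl _ _)
          rw [← hτv _ hv hne]
          exact hstep _ ih
    obtain ⟨i, hi⟩ := hu.exists_nat_pow_eq
    exact hi ▸ this i
  · exact htQ

open Equiv.Perm in
/-- A connected finite digraph with a spanning permutation, in which vertices with a common
successor have the same successors, has a Hamiltonian cycle. -/
theorem exists_isCycleOn_of_common_successors {S : Type*} [Fintype S] [DecidableEq S]
    (r : S → S → Prop) (s₀ : S) (σ₀ : Equiv.Perm S) (hσ₀ : ∀ s, r s (σ₀ s))
    (hr : ∀ s s' t u, r s t → r s' t → r s u → r s' u)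
    (hconn : ∀ O : Set S, s₀ ∈ O → (∀ s ∈ O, ∀ t, r s t → t ∈ O) → O = Set.univ) :
    ∃ σ : Equiv.Perm S, (∀ s, r s (σ s)) ∧ σ.IsCycleOn Set.univ := by
  classical
  obtain ⟨σ, hσ, hmax⟩ := Finset.exists_max_image
    (Finset.univ.filter fun σ : Equiv.Perm S => ∀ s, r s (σ s))
    (fun σ => Set.ncard {t | σ.SameCycle s₀ t}) ⟨σ₀, by simpa using hσ₀⟩
  simp only [Finset.mem_filter, Finset.mem_univ, true_and] at hσ hmax
  have huniv : {t | σ.SameCycle s₀ t} = Set.univ := by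
    refine hconn _ (SameCycle.refl _ _) fun s hs t hst => ?_
    by_contra ht
    have hs : σ.SameCycle s₀ s := hs
    have ht : ¬ σ.SameCycle s t := fun h => ht (hs.trans h)
    have hval : ∀ v, r v ((σ * Equiv.swap s (σ⁻¹ t)) v) := by
      intro v
      rw [Equiv.Perm.mul_apply]
      by_cases h1 : v = s
      · subst h1; simpa using hst
      by_cases h2 : v = σ⁻¹ t
      · subst h2
        rw [Equiv.swap_apply_right]
        refine hr s _ t _ hst ?_ (hσ s)
        simpa using hσ (σ⁻¹ t)
      · rw [Equiv.swap_apply_of_ne_of_ne h1 h2]; exact hσ v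
    have hlt : Set.ncard {u | σ.SameCycle s₀ u} <
        Set.ncard {u | (σ * Equiv.swap s (σ⁻¹ t)).SameCycle s₀ u} := by
      have h0 := sameCycle_mul_swap ht (Or.inl hs.symm)
      refine Set.ncard_lt_ncard ?_ (Set.toFinite _)
      refine ⟨fun u hu => ?_, fun hsub => ht (hs.symm.trans (hsub ?_))⟩
      · exact h0.symm.trans (sameCycle_mul_swap ht (Or.inl (hs.symm.trans hu)))
      · exact h0.symm.trans (sameCycle_mul_swap ht (Or.inr rfl))
    exact absurd (hmax _ hval) (not_le.2 hlt)
  refine ⟨σ, hσ, σ.bijective.bijOn_univ, fun x _ y _ => ?_⟩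
  have hall : ∀ x, σ.SameCycle s₀ x := fun x => by
    have : x ∈ {t | σ.SameCycle s₀ t} := huniv ▸ Set.mem_univ x
    exact this
  exact (hall x).symm.trans (hall y)

/-- The state reached from state `s` by reading the symbol `a`. -/
def pushState {A : Type*} {k : ℕ} (s : Fin k → A) (a : A) : Fin k → A :=
  fun i => if h : i.1 + 1 < k then s ⟨i.1 + 1, h⟩ else a

/-- The de Bruijn graph of any order has a Hamiltonian cycle. -/
theorem exists_deBruijn_cycle {A : Type*} [Fintype A] [DecidableEq A] [Inhabited A] (k : ℕ) :
    ∃ σ : Equiv.Perm (Fin k → A), (∀ s, ∃ a, σ s = pushState s a) ∧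
      σ.IsCycleOn Set.univ := by
  refine exists_isCycleOn_of_common_successors
    (fun s t : Fin k → A => ∃ a, t = pushState s a) default
    ((finRotate k).symm.arrowCongr (Equiv.refl A)) ?_ ?_ ?_
  · intro s
    cases k with
    | zero => exact ⟨default, Subsingleton.elim _ _⟩
    | succ k =>
      refine ⟨s 0, funext fun i => ?_⟩
      simp only [Equiv.arrowCongr_apply, Equiv.coe_refl, Equiv.symm_symm, Function.comp_apply, id,
        pushState]
      split_ifs with h
      · congr 1
        rw [finRotate_of_lt (by omega)]
      · have : i = Fin.last k := Fin.ext (by simp; omega)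
        rw [this, finRotate_last]
  · rintro s s' t u ⟨a, rfl⟩ ⟨a', h⟩ ⟨b, rfl⟩
    refine ⟨b, funext fun i => ?_⟩
    have := congrFun h i
    simp only [pushState] at this ⊢
    split_ifs with hi
    · simpa [hi] using this
    · rfl
  · intro O h0 hO
    refine Set.eq_univ_of_forall fun t => ?_
    have hex : ∀ j, ∀ _ : j ≤ k, ∃ s ∈ O, ∀ i (hi : i < k) (hj : k ≤ i + j),
        s ⟨i, hi⟩ = t ⟨i + j - k, by omega⟩ := by
      intro j hj
      induction j with
      | zero => exact ⟨default, h0, fun i hi hj => absurd hj (by omega)⟩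
      | succ j ih =>
        obtain ⟨s, hs, hst⟩ := ih (by omega)
        refine ⟨pushState s (t ⟨j, by omega⟩), hO s hs _ ⟨_, rfl⟩, fun i hi hij => ?_⟩
        simp only [pushState]
        split_ifs with h
        · rw [hst (i + 1) h (by omega)]
          congr 2
          omega
        · congr 2
          omega
    obtain ⟨s, hs, hst⟩ := hex k le_rfl
    have : s = t := funext fun i => by simpa using hst i i.2 (by omega)
    exact this ▸ hs

/-- The list of transitions (state, symbol read) along the string `x`, starting from `s`. -/
def transitions {A : Type*} {k : ℕ} : (Fin k → A) → List A → List ((Fin k → A) × A)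
  | _, [] => []
  | s, a :: x => (s, a) :: transitions (pushState s a) x

/-- The state reached from `s` by reading the string `x`. -/
def finalState {A : Type*} {k : ℕ} (s : Fin k → A) (x : List A) : Fin k → A :=
  x.foldl pushState s

section Transitions

variable {A : Type*} {k : ℕ}

theorem length_transitions (s : Fin k → A) (x : List A) :
    (transitions s x).length = x.length := by
  induction x generalizing s with
  | nil => rfl
  | cons a x ih => simp [transitions, ih]

theorem transitions_concat (s : Fin k → A) (x : List A) (a : A) :
    transitions s (x ++ [a]) = transitions s x ++ [(finalState s x, a)] := by
  induction x generalizing s with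
  | nil => rfl
  | cons b x ih => simp [transitions, ih, finalState]

theorem sum_transitions_sub {R : Type*} [AddCommGroup R] (g : (Fin k → A) → R)
    (s : Fin k → A) (x : List A) :
    ((transitions s x).map fun e => g (pushState e.1 e.2) - g e.1).sum =
      g (finalState s x) - g s := by
  induction x generalizing s with
  | nil => simp [transitions, finalState]
  | cons a x ih => simp [transitions, ih, finalState]

theorem finalState_eq_of_perm {s : Fin k → A} {x y : List A}
    (h : (transitions s x).Perm (transitions s y)) : finalState s x = finalState s y := by
  classical
  have := (h.map fun e =>
    (Pi.single (finalState s x) 1 : (Fin k → A) → ℤ) (pushState e.1 e.2) -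
      (Pi.single (finalState s x) 1 : (Fin k → A) → ℤ) e.1).sum_eq
  rw [sum_transitions_sub, sum_transitions_sub, sub_left_inj, Pi.single_eq_same] at this
  by_contra hne
  rw [Pi.single_eq_of_ne (Ne.symm hne)] at this
  exact one_ne_zero this

theorem transitions_concat_perm {s : Fin k → A} {x y : List A}
    (h : (transitions s x).Perm (transitions s y)) (a : A) :
    (transitions s (x ++ [a])).Perm (transitions s (y ++ [a])) := by
  rw [transitions_concat, transitions_concat, finalState_eq_of_perm h]
  exact h.append_right _

variable [Inhabited A]

theorem ctxL_zero (s : Fin k → A) (x : List A) : ctxL k s x 0 = s := by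
  funext i
  have h1 : ¬ (0 : ℤ) ≤ ((0 : ℕ) : ℤ) - k + i := by omega
  have h2 : (((0 : ℕ) : ℤ) - k + i + k).toNat = i := by omega
  simp only [ctxL, symL, dif_neg h1, h2]
  simp

theorem ctxL_cons_succ (s : Fin k → A) (a : A) (x : List A) (t : ℕ) :
    ctxL k s (a :: x) (t + 1) = ctxL k (pushState s a) x t := by
  funext i
  simp only [ctxL, symL, pushState]
  rcases lt_trichotomy (t + i.1 + 1) k with h | h | h
  · have h1 : (((t + 1 : ℕ) : ℤ) - k + i + k).toNat = t + i + 1 := by omega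
    have h2 : ((t : ℤ) - k + i + k).toNat = t + i := by omega
    have h3 : t + i.1 < k := by omega
    have h4 : ¬ (0 : ℤ) ≤ ((t + 1 : ℕ) : ℤ) - k + i := by omega
    have h5 : ¬ (0 : ℤ) ≤ (t : ℤ) - k + i := by omega
    simp only [dif_neg h4, dif_neg h5, h1, h2, h, h3, dif_pos]
  · have h0 : ((t + 1 : ℕ) : ℤ) - k + i = (0 : ℕ) := by omega
    have h2 : ((t : ℤ) - k + i + k).toNat = t + i := by omega
    have h3 : t + i.1 < k := by omega
    rw [dif_neg (show ¬ (0 : ℤ) ≤ (t : ℤ) - k + i by omega), h0]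
    simp [h2, h3, h.not_lt]
  · obtain ⟨m, hm⟩ : ∃ m : ℕ, (t : ℤ) - k + i = m := ⟨((t : ℤ) - k + i).toNat, by omega⟩
    have hm' : ((t + 1 : ℕ) : ℤ) - k + i = (m + 1 : ℕ) := by omega
    rw [hm, hm', dif_pos (Int.natCast_nonneg _), dif_pos (Int.natCast_nonneg _)]
    simp only [Int.toNat_natCast, List.length_cons, Nat.add_lt_add_iff_right]
    rfl

theorem ofFn_ctxL_get (s : Fin k → A) (x : List A) :
    (List.ofFn fun t : Fin x.length => (ctxL k s x t, x.get t)) = transitions s x := by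
  induction x generalizing s with
  | nil => rfl
  | cons a x ih =>
    rw [transitions, ← ih, List.ofFn_succ]
    simp [ctxL_zero, ctxL_cons_succ]

theorem seqProbL_eq_prod_transitions (s : Fin k → A) (p : (Fin k → A) → A → ℝ) (x : List A) :
    seqProbL k s p x = ((transitions s x).map fun e => p e.1 e.2).prod := by
  rw [← ofFn_ctxL_get, List.map_ofFn, List.prod_ofFn]
  rfl

theorem countL_eq_count_transitions [DecidableEq A] (s₀ s : Fin k → A) (a : A) (x : List A) :
    countL k s₀ s a x = (transitions s₀ x).count (s, a) := by
  rw [← ofFn_ctxL_get, List.ofFn_eq_map, List.count, List.countP_map,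
    List.countP_eq_length_filter]
  unfold countL sfilter
  rw [Fin.univ_def]
  change (List.filter _ _).length = _
  congr 2
  funext t
  rw [Bool.eq_iff_iff]
  simp

theorem sameTypeL_iff_perm [DecidableEq A] (s₀ : Fin k → A) (x y : List A) :
    sameTypeL k s₀ x y ↔ (transitions s₀ x).Perm (transitions s₀ y) := by
  rw [List.perm_iff_count]
  constructor
  · rintro ⟨-, h⟩ ⟨s, a⟩
    simpa only [countL_eq_count_transitions] using h s a
  · intro h
    refine ⟨?_, fun s a => by simpa only [countL_eq_count_transitions] using h (s, a)⟩
    simpa only [length_transitions] using (List.perm_iff_count.2 h).length_eq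

theorem seqProbL_congr {s : Fin k → A} {x y : List A}
    (h : (transitions s x).Perm (transitions s y)) (p : (Fin k → A) → A → ℝ) :
    seqProbL k s p x = seqProbL k s p y := by
  rw [seqProbL_eq_prod_transitions, seqProbL_eq_prod_transitions, (h.map _).prod_eq]

theorem seqProbL_pos [Fintype A] {p : (Fin k → A) → A → ℝ} (hp : IsMarkov k p)
    (s : Fin k → A) (x : List A) : 0 < seqProbL k s p x :=
  Finset.prod_pos fun _ _ => hp.1 _ _

theorem sum_seqProbL_concat [Fintype A] {p : (Fin k → A) → A → ℝ} (hp : IsMarkov k p)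
    (s : Fin k → A) (x : List A) : ∑ a, seqProbL k s p (x ++ [a]) = seqProbL k s p x := by
  simp only [seqProbL_eq_prod_transitions, transitions_concat, List.map_append, List.prod_append,
    List.map_cons, List.map_nil, List.prod_singleton]
  rw [← Finset.mul_sum, hp.2, mul_one]

end Transitions

theorem List.sum_map_eq_sum_count {E R : Type*} [Fintype E] [BEq E] [LawfulBEq E]
    [AddCommMonoid R] (l : List E) (f : E → R) : (l.map f).sum = ∑ e, l.count e • f e := by
  classical
  induction l with
  | nil => simp
  | cons a l ih =>
    simp [ih, List.count_cons, add_smul, Finset.sum_add_distrib, ite_smul, add_comm]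

/-- Given a Hamiltonian cycle of the de Bruijn graph, two strings of the same length with the same
transition counts off the cycle have the same type. -/
theorem transitions_perm_of_count_eq {A : Type*} [Fintype A] [DecidableEq A] {k : ℕ}
    {σ : Equiv.Perm (Fin k → A)} (hσ : σ.IsCycleOn Set.univ) {c : (Fin k → A) → A}
    (hc : ∀ s, σ s = pushState s (c s)) (s₀ : Fin k → A) {x y : List A}
    (hlen : x.length = y.length)
    (h : ∀ e : (Fin k → A) × A, e.2 ≠ c e.1 →
      (transitions s₀ x).count e = (transitions s₀ y).count e) :
    (transitions s₀ x).Perm (transitions s₀ y) := by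
  have hσ' : σ.IsCycleOn (Finset.univ : Finset (Fin k → A)) := by simpa using hσ
  set d : (Fin k → A) → ℤ := fun s =>
    (transitions s₀ x).count (s, c s) - (transitions s₀ y).count (s, c s) with hd
  have key : ∀ {R : Type} [CommRing R] (φ : (Fin k → A) × A → R),
      ((transitions s₀ x).map φ).sum - ((transitions s₀ y).map φ).sum =
        ∑ s, (d s : R) * φ (s, c s) := by
    intro R _ φ
    rw [List.sum_map_eq_sum_count, List.sum_map_eq_sum_count, ← Finset.sum_sub_distrib,
      Fintype.sum_prod_type]
    refine Finset.sum_congr rfl fun s _ => ?_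
    rw [Finset.sum_eq_single (c s)]
    · simp [hd, sub_mul]
    · intro a _ ha
      rw [h (s, a) ha, sub_self]
    · simp
  have hsum : ∑ s, d s = 0 := by
    have := key (R := ℤ) fun _ => 1
    simpa [length_transitions, hlen] using this.symm
  have hreach : ∀ s, ∃ n : ℕ, (σ ^ n) s₀ = s := fun s =>
    let ⟨n, _, hn⟩ := hσ'.exists_pow_eq (Finset.mem_univ s₀) (Finset.mem_univ s)
    ⟨n, hn⟩
  choose pos hpos using hreach
  set L := (Finset.univ : Finset (Fin k → A)).card with hL
  have hfin : finalState s₀ x = finalState s₀ y := by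
    have hstep : ∀ s, ((pos (pushState s (c s)) : ℕ) : ZMod L) - (pos s : ZMod L) = 1 := by
      intro s
      rw [sub_eq_iff_eq_add, add_comm, ← Nat.cast_succ, ZMod.natCast_eq_natCast_iff]
      rw [← hσ'.pow_apply_eq_pow_apply (Finset.mem_univ s₀), hpos, pow_succ',
        Equiv.Perm.mul_apply, hpos, hc]
    have := key (R := ZMod L) fun e => (pos (pushState e.1 e.2) : ZMod L) - (pos e.1 : ZMod L)
    rw [sum_transitions_sub (fun s => (pos s : ZMod L)),
      sum_transitions_sub (fun s => (pos s : ZMod L))] at this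
    simp only [hstep, mul_one, sub_sub_sub_cancel_right] at this
    rw [← Int.cast_sum, hsum, Int.cast_zero, sub_eq_zero, ZMod.natCast_eq_natCast_iff,
      ← hσ'.pow_apply_eq_pow_apply (Finset.mem_univ s₀), hpos, hpos] at this
    exact this
  have hdσ : ∀ s, d (σ s) = d s := by
    intro s
    set g : (Fin k → A) → ℤ := Pi.single (σ s) 1 with hg
    have := key (R := ℤ) fun e => g (pushState e.1 e.2) - g e.1
    rw [sum_transitions_sub g, sum_transitions_sub g, hfin, sub_self] at this
    simp only [← hc, mul_sub, Finset.sum_sub_distrib, Int.cast_id] at this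
    have h1 : ∑ t, d t * g (σ t) = d s := by
      rw [Finset.sum_eq_single s] <;> simp +contextual [hg]
    have h2 : ∑ t, d t * g t = d (σ s) := by
      rw [Finset.sum_eq_single (σ s)] <;> simp +contextual [hg]
    linarith
  have hconst : ∀ s, d s = d s₀ := by
    intro s
    rw [← hpos s]
    generalize pos s = n
    induction n with
    | zero => rfl
    | succ n ih => rw [pow_succ', Equiv.Perm.mul_apply, hdσ, ih]
  have hd0 : d s₀ = 0 := by
    simp only [hconst, Finset.sum_const, nsmul_eq_mul] at hsum
    rcases mul_eq_zero.1 hsum with h0 | h0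
    · exact absurd (Finset.card_eq_zero.1 (Nat.cast_eq_zero.1 h0)) (Finset.ne_empty_of_mem
        (Finset.mem_univ s₀))
    · exact h0
  rw [List.perm_iff_count]
  rintro ⟨s, a⟩
  by_cases ha : a = c s
  · subst ha
    have := (hconst s).trans hd0
    simp only [hd] at this
    omega
  · exact h (s, a) ha

open Filter Topology in
/-- Functions of the form `t ^ W * u t`, with `u` continuous and `u 0 = 1`, are linearly independent
near `0⁺` for distinct exponents `W`. -/
theorem sum_fiber_eq_zero_of_eventually {ι : Type*} (X : Finset ι) (c : ι → ℝ) (W : ι → ℕ)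
    (u : ι → ℝ → ℝ) (hu : ∀ x ∈ X, ContinuousAt (u x) 0) (hu0 : ∀ x ∈ X, u x 0 = 1)
    (huW : ∀ x ∈ X, ∀ y ∈ X, W x = W y → u x = u y)
    (h : ∀ᶠ t in 𝓝[>] (0 : ℝ), ∑ x ∈ X, c x * (t ^ W x * u x t) = 0) (v : ℕ) :
    ∑ x ∈ X with W x = v, c x = 0 := by
  induction v using Nat.strong_induction_on with
  | _ v ih =>
  have hlow : ∀ t : ℝ, ∑ x ∈ X with W x < v, c x * (t ^ W x * u x t) = 0 := by
    intro t
    rw [← Finset.sum_fiberwise_of_maps_to (t := Finset.range v) (g := W)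
      (fun x hx => Finset.mem_range.2 (Finset.mem_filter.1 hx).2)]
    refine Finset.sum_eq_zero fun w hw => ?_
    have hw := Finset.mem_range.1 hw
    have hset : (X.filter fun x => W x < v).filter (fun x => W x = w) =
        X.filter fun x => W x = w := by
      ext x
      simp only [Finset.mem_filter]
      constructor
      · rintro ⟨⟨h1, -⟩, h2⟩; exact ⟨h1, h2⟩
      · rintro ⟨h1, h2⟩; exact ⟨⟨h1, h2 ▸ hw⟩, h2⟩
    rw [hset]
    rcases (X.filter fun x => W x = w).eq_empty_or_nonempty with h0 | ⟨y, hy⟩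
    · rw [h0, Finset.sum_empty]
    · have hy := Finset.mem_filter.1 hy
      calc ∑ x ∈ X with W x = w, c x * (t ^ W x * u x t)
          = ∑ x ∈ X with W x = w, c x * (t ^ W y * u y t) := by
            refine Finset.sum_congr rfl fun x hx => ?_
            have hx := Finset.mem_filter.1 hx
            have hxy := hx.2.trans hy.2.symm
            rw [huW x hx.1 y hy.1 hxy, hxy]
        _ = 0 := by rw [← Finset.sum_mul, ih w hw, zero_mul]
  set G : ℝ → ℝ := fun t => ∑ x ∈ X with ¬ W x < v, c x * (t ^ (W x - v) * u x t) with hG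
  have hGc : ContinuousAt G 0 := by
    refine tendsto_finsetSum _ fun x hx => ?_
    have := hu x (Finset.mem_filter.1 hx).1
    exact (continuousAt_const.mul ((continuousAt_id.pow _).mul this))
  have hGz : ∀ᶠ t in 𝓝[>] (0 : ℝ), G t = 0 := by
    filter_upwards [h, self_mem_nhdsWithin] with t ht htpos
    have htpos : 0 < t := htpos
    rw [← Finset.sum_filter_add_sum_filter_not X (fun x => W x < v), hlow, zero_add] at ht
    have : t ^ v * G t = 0 := by
      rw [← ht, hG, Finset.mul_sum]
      refine Finset.sum_congr rfl fun x hx => ?_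
      have hx := not_lt.1 (Finset.mem_filter.1 hx).2
      calc t ^ v * (c x * (t ^ (W x - v) * u x t))
          = c x * ((t ^ v * t ^ (W x - v)) * u x t) := by ring
        _ = _ := by rw [← pow_add, Nat.add_sub_cancel' hx]
    exact (mul_eq_zero.1 this).resolve_left (pow_pos htpos v).ne'
  have hG0 : G 0 = 0 := tendsto_nhds_unique (hGc.tendsto.mono_left nhdsWithin_le_nhds)
    ((tendsto_congr' hGz).2 tendsto_const_nhds)
  rw [← hG0, hG]
  have hset : X.filter (fun x => W x = v) =
      (X.filter fun x => ¬ W x < v).filter fun x => W x = v := by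
    ext x
    simp only [Finset.mem_filter]
    constructor
    · rintro ⟨h1, h2⟩; exact ⟨⟨h1, by omega⟩, h2⟩
    · rintro ⟨⟨h1, -⟩, h2⟩; exact ⟨h1, h2⟩
  rw [hset, Finset.sum_filter]
  refine Finset.sum_congr rfl fun x hx => ?_
  have hx := Finset.mem_filter.1 hx
  split_ifs with hv
  · simp [hv, hu0 x hx.1]
  · have : W x - v ≠ 0 := by omega
    simp [zero_pow this]

/-- The type of the string `x`: the multiset of its transitions. -/
def stringType {A : Type*} {k : ℕ} (s₀ : Fin k → A) (x : List A) : Multiset ((Fin k → A) × A) :=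
  transitions s₀ x

theorem stringType_eq_iff {A : Type*} {k : ℕ} {s₀ : Fin k → A} {x y : List A} :
    stringType s₀ x = stringType s₀ y ↔ (transitions s₀ x).Perm (transitions s₀ y) :=
  Multiset.coe_eq_coe

theorem length_eq_of_stringType_eq {A : Type*} {k : ℕ} {s₀ : Fin k → A} {x y : List A}
    (h : stringType s₀ x = stringType s₀ y) :
    x.length = y.length := by
  simpa [length_transitions] using (stringType_eq_iff.1 h).length_eq

/-- Digits of a base exceeding all of them are determined by the number they represent. -/
theorem eq_of_sum_mul_pow_eq {E : Type*} [Fintype E] {m B : ℕ} (i : E ≃ Fin m) {f g : E → ℕ}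
    (hf : ∀ e, f e < B) (hg : ∀ e, g e < B)
    (h : ∑ e, f e * B ^ (i e : ℕ) = ∑ e, g e * B ^ (i e : ℕ)) : f = g := by
  have hsum : ∀ (f : E → ℕ) (hf : ∀ e, f e < B),
      (finFunctionFinEquiv fun j : Fin m => (⟨f (i.symm j), hf _⟩ : Fin B) : ℕ) =
        ∑ e, f e * B ^ (i e : ℕ) := by
    intro f hf
    rw [finFunctionFinEquiv_apply, ← i.sum_comp]
    simp
  have := finFunctionFinEquiv.injective (Fin.ext ((hsum f hf).trans (h.trans (hsum g hg).symm)))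
  funext e
  simpa using congrArg Fin.val (congrFun this (i e))

/-- Some nonnegative integer weights on transitions, vanishing exactly on the chosen Hamiltonian
cycle of the de Bruijn graph, separate the types of strings of length `n`. -/
theorem exists_separating_weights {A : Type*} [Fintype A] [DecidableEq A] [Inhabited A] {k : ℕ}
    (s₀ : Fin k → A) (n : ℕ) :
    ∃ (c : (Fin k → A) → A) (w : (Fin k → A) × A → ℕ), (∀ e, w e = 0 ↔ e.2 = c e.1) ∧
      ∀ x y : List A, x.length = n → y.length = n →
        ((transitions s₀ x).map w).sum = ((transitions s₀ y).map w).sum →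
        stringType s₀ x = stringType s₀ y := by
  obtain ⟨σ, hσ, hcyc⟩ := exists_deBruijn_cycle (A := A) k
  choose c hc using hσ
  let i := Fintype.equivFin ((Fin k → A) × A)
  refine ⟨c, fun e => if e.2 = c e.1 then 0 else (n + 1) ^ (i e : ℕ), fun e => ?_,
    fun x y hx hy hxy => ?_⟩
  · simp
  · rw [List.sum_map_eq_sum_count, List.sum_map_eq_sum_count] at hxy
    have hmul : ∀ z : List A, ∀ e, (transitions s₀ z).count e •
        (if e.2 = c e.1 then 0 else (n + 1) ^ (i e : ℕ)) =
        (if e.2 = c e.1 then 0 else (transitions s₀ z).count e) * (n + 1) ^ (i e : ℕ) := by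
      intro z e
      split_ifs <;> simp
    simp only [hmul] at hxy
    have hlt : ∀ z : List A, z.length = n → ∀ e : (Fin k → A) × A,
        (if e.2 = c e.1 then 0 else (transitions s₀ z).count e) < n + 1 := by
      intro z hz e
      have : (transitions s₀ z).count e ≤ n := by
        rw [← hz, ← length_transitions s₀ z]
        exact List.count_le_length
      split_ifs <;> omega
    have heq := eq_of_sum_mul_pow_eq i (hlt x hx) (hlt y hy) hxy
    refine stringType_eq_iff.2 (transitions_perm_of_count_eq hcyc hc s₀ (hx.trans hy.symm)
      fun e he => ?_)
    simpa [he] using congrFun heq e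

open Filter Topology in
/-- The probabilities of the types of strings of a given length are linearly independent as
functions of the Markov process. -/
theorem sum_eq_zero_of_forall_isMarkov {A : Type*} [Fintype A] [DecidableEq A] [Inhabited A]
    {k n : ℕ} (s₀ : Fin k → A) (X : Finset (List A)) (hX : ∀ x ∈ X, x.length = n)
    (f : List A → ℝ)
    (h : ∀ p : (Fin k → A) → A → ℝ, IsMarkov k p → ∑ x ∈ X, f x * seqProbL k s₀ p x = 0)
    {y : List A} (hy : y.length = n) :
    ∑ x ∈ X with stringType s₀ x = stringType s₀ y, f x = 0 := by
  obtain ⟨c, w, hw, hsep⟩ := exists_separating_weights s₀ n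
  set q : ℝ → (Fin k → A) → ℝ := fun t s => 1 - ∑ a ∈ Finset.univ.erase (c s), t ^ w (s, a)
    with hq
  set u : ℝ → (Fin k → A) × A → ℝ := fun t e => if e.2 = c e.1 then q t e.1 else 1 with hu
  have hqc : ∀ s, Continuous fun t => q t s := fun s => by fun_prop
  have hq0 : ∀ s, q 0 s = 1 := by
    intro s
    rw [hq]
    simp only [sub_eq_self]
    refine Finset.sum_eq_zero fun a ha => ?_
    exact zero_pow fun h0 => (Finset.mem_erase.1 ha).1 ((hw (s, a)).1 h0)
  have huc : ∀ e, Continuous fun t => u t e := by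
    intro e
    simp only [hu]
    split_ifs
    · exact hqc _
    · exact continuous_const
  have hu0 : ∀ e, u 0 e = 1 := by
    intro e
    simp only [hu, hq0, ite_self]
  have hpos : ∀ᶠ t in 𝓝[>] (0 : ℝ), ∀ s, 0 < q t s := by
    rw [eventually_all]
    intro s
    have : Tendsto (fun t => q t s) (𝓝[>] (0 : ℝ)) (𝓝 1) :=
      hq0 s ▸ ((hqc s).tendsto 0).mono_left nhdsWithin_le_nhds
    exact this.eventually_const_lt one_pos
  have hW : ∀ x ∈ X, ((transitions s₀ x).map w).sum = ((transitions s₀ y).map w).sum ↔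
      stringType s₀ x = stringType s₀ y := fun x hx =>
    ⟨hsep x y (hX x hx) hy, fun hxy => ((stringType_eq_iff.1 hxy).map w).sum_eq⟩
  rw [← Finset.filter_congr hW]
  refine sum_fiber_eq_zero_of_eventually X f _ (fun x t => ((transitions s₀ x).map (u t)).prod)
    ?_ ?_ ?_ ?_ _
  · intro x _
    exact (continuous_list_prod _ fun e _ => huc e).continuousAt
  · intro x _
    simp [funext hu0]
  · intro x hx z hz hxz
    funext t
    exact ((stringType_eq_iff.1 (hsep x z (hX x hx) (hX z hz) hxz)).map (u t)).prod_eq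
  · filter_upwards [hpos, self_mem_nhdsWithin] with t ht ht0
    have ht0 : 0 < t := ht0
    have hp : IsMarkov k fun s a => t ^ w (s, a) * u t (s, a) := by
      refine ⟨fun s a => mul_pos (pow_pos ht0 _) ?_, fun s => ?_⟩
      · simp only [hu]
        split_ifs
        · exact ht s
        · exact one_pos
      · rw [← Finset.add_sum_erase _ _ (Finset.mem_univ (c s))]
        have h1 : w (s, c s) = 0 := (hw _).2 rfl
        have h2 : ∑ a ∈ Finset.univ.erase (c s), t ^ w (s, a) * u t (s, a) =
            ∑ a ∈ Finset.univ.erase (c s), t ^ w (s, a) := by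
          refine Finset.sum_congr rfl fun a ha => ?_
          simp [hu, (Finset.mem_erase.1 ha).1]
        rw [h2]
        simp [h1, hu, hq]
    rw [← h _ hp]
    refine Finset.sum_congr rfl fun x _ => ?_
    rw [seqProbL_eq_prod_transitions, List.prod_map_mul]
    congr 2
    generalize transitions s₀ x = l
    induction l with
    | nil => simp
    | cons e l ih => simp [pow_add, ih]

theorem mem_sfilter {α : Type*} {p : α → Prop} {s : Finset α} {a : α} :
    a ∈ sfilter p s ↔ a ∈ s ∧ p a := by
  classical
  exact Finset.mem_filter

section Dictionaries

variable {A : Type*} [Fintype A] [DecidableEq A]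

theorem mem_lists {n : ℕ} {x : List A} : x ∈ lists A n ↔ x.length = n := by
  induction n generalizing x with
  | zero => simp [lists]
  | succ n ih => cases x <;> simp [lists, ih]

theorem sum_lists_succ {R : Type*} [AddCommMonoid R] (n : ℕ) (f : List A → R) :
    ∑ z ∈ lists A (n + 1), f z = ∑ y ∈ lists A n, ∑ a, f (y ++ [a]) := by
  rw [← Finset.sum_product']
  symm
  refine Finset.sum_bij (fun q _ => q.1 ++ [q.2]) ?_ ?_ ?_ ?_
  · rintro ⟨y, a⟩ h
    simpa [mem_lists] using h
  · rintro ⟨y, a⟩ _ ⟨y', a'⟩ _ h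
    simpa using h
  · intro z hz
    have hz : z.length = n + 1 := mem_lists.1 hz
    have hne : z ≠ [] := by rintro rfl; simp at hz
    exact ⟨(z.dropLast, z.getLast hne), by simp [mem_lists, hz],
      List.dropLast_append_getLast hne⟩
  · intros
    rfl

theorem mem_failAt {D : Set (List A)} {n : ℕ} {x : List A} :
    x ∈ failAt D n ↔ x.length = n ∧ ¬ ∃ y ∈ D, y <+: x := by
  rw [failAt, mem_sfilter, mem_lists]

theorem mem_dictAt {D : Set (List A)} {n : ℕ} {x : List A} :
    x ∈ dictAt D n ↔ x.length = n ∧ x ∈ D := by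
  rw [dictAt, mem_sfilter, mem_lists]

theorem failAt_empty (n : ℕ) : failAt (∅ : Set (List A)) n = lists A n := by
  ext x
  simp [mem_failAt, mem_lists]

theorem dictAt_empty (n : ℕ) : dictAt (∅ : Set (List A)) n = ∅ := by
  ext x
  simp [mem_dictAt]

/-- The one-symbol extensions of the failures at level `n` are the failures and the dictionary
strings at level `n + 1`. -/
theorem sum_failAt_succ_add_sum_dictAt_succ {R : Type*} [AddCommMonoid R] {D : Set (List A)}
    (hD : PrefixFree D) (n : ℕ) (f : List A → R) :
    ∑ z ∈ failAt D (n + 1), f z + ∑ z ∈ dictAt D (n + 1), f z =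
      ∑ y ∈ failAt D n, ∑ a, f (y ++ [a]) := by
  classical
  have hdisj : Disjoint (failAt D (n + 1)) (dictAt D (n + 1)) := by
    rw [Finset.disjoint_left]
    intro z h1 h2
    exact (mem_failAt.1 h1).2 ⟨z, (mem_dictAt.1 h2).2, List.prefix_rfl⟩
  have hfail : failAt D n = (lists A n).filter fun x => ¬ ∃ y ∈ D, y <+: x := by
    ext x
    rw [mem_failAt, Finset.mem_filter, mem_lists]
  have hunion : failAt D (n + 1) ∪ dictAt D (n + 1) =
      (lists A (n + 1)).filter fun z => ¬ ∃ y ∈ D, y <+: z.dropLast := by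
    ext z
    rw [Finset.mem_union, mem_failAt, mem_dictAt, Finset.mem_filter, mem_lists, ← and_or_left]
    refine and_congr_right fun hz => ?_
    have hne : z ≠ [] := by rintro rfl; simp at hz
    constructor
    · rintro (h | h)
      · rintro ⟨y, hy, hyz⟩
        exact h ⟨y, hy, hyz.trans (List.dropLast_prefix z)⟩
      · rintro ⟨y, hy, hyz⟩
        have hyz' := hD y hy z h (hyz.trans (List.dropLast_prefix z))
        have := hyz.length_le
        rw [hyz', List.length_dropLast] at this
        omega
    · intro h
      by_cases hzD : z ∈ D
      · exact Or.inr hzD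
      · left
        rintro ⟨y, hy, hyz⟩
        rw [← List.dropLast_append_getLast hne, List.prefix_concat_iff,
          List.dropLast_append_getLast hne] at hyz
        rcases hyz with rfl | hyz
        · exact hzD hy
        · exact h ⟨y, hy, hyz⟩
  rw [← Finset.sum_union hdisj, hunion, Finset.sum_filter, sum_lists_succ, hfail,
    Finset.sum_filter]
  refine Finset.sum_congr rfl fun y _ => ?_
  simp only [List.dropLast_concat]
  split_ifs <;> simp

variable {k : ℕ} {s₀ : Fin k → A}

theorem sum_eq_sum_card_smul {R : Type*} [AddCommMonoid R] {X : Finset (List A)} {n : ℕ}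
    (hX : ∀ x ∈ X, x.length = n) (G : Multiset ((Fin k → A) × A) → R) :
    ∑ x ∈ X, G (stringType s₀ x) = ∑ b ∈ (lists A n).image (stringType s₀),
      (X.filter fun x => stringType s₀ x = b).card • G b := by
  rw [← Finset.sum_fiberwise_of_maps_to (t := (lists A n).image (stringType s₀))
    (g := stringType s₀)
    fun x hx => Finset.mem_image_of_mem _ (mem_lists.2 (hX x hx))]
  refine Finset.sum_congr rfl fun b _ => ?_
  rw [← Finset.sum_const]
  exact Finset.sum_congr rfl fun x hx => by rw [(Finset.mem_filter.1 hx).2]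

/-- The numbers of failures of each type at level `n` determine, for each type, how many strings
of level `n + 1` either fail or are in the dictionary. -/
theorem exists_card_failAt_succ_add_card_dictAt_succ (s₀ : Fin k → A)
    (b : Multiset ((Fin k → A) × A)) :
    ∃ E : Multiset ((Fin k → A) × A) → ℕ, ∀ D : Set (List A), PrefixFree D → ∀ n,
      ((failAt D (n + 1)).filter fun x => stringType s₀ x = b).card +
        ((dictAt D (n + 1)).filter fun x => stringType s₀ x = b).card =
      ∑ c ∈ (lists A n).image (stringType s₀),
        ((failAt D n).filter fun x => stringType s₀ x = c).card * E c := by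
  have hinv : Function.FactorsThrough
      (fun y : List A => ∑ a, if stringType s₀ (y ++ [a]) = b then 1 else 0)
      (stringType s₀) := by
    intro x y hxy
    refine Finset.sum_congr rfl fun a _ => ?_
    rw [stringType_eq_iff.2 (transitions_concat_perm (stringType_eq_iff.1 hxy) a)]
  obtain ⟨E, hE⟩ := (Function.factorsThrough_iff _).1 hinv
  refine ⟨E, fun D hD n => ?_⟩
  rw [Finset.card_filter, Finset.card_filter, sum_failAt_succ_add_sum_dictAt_succ hD]
  simp only [← smul_eq_mul]
  rw [← sum_eq_sum_card_smul fun x hx => (mem_failAt.1 hx).1]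
  exact Finset.sum_congr rfl fun y _ => congrFun hE y

theorem card_failAt_modEq {D : Set (List A)} {M : ℕ} (hD : PrefixFree D) (hnil : [] ∉ D)
    (hdvd : ∀ n b, M ∣ ((dictAt D n).filter fun x => stringType s₀ x = b).card) (n : ℕ)
    (b : Multiset ((Fin k → A) × A)) :
    ((failAt D n).filter fun x => stringType s₀ x = b).card ≡
      ((lists A n).filter fun x => stringType s₀ x = b).card [MOD M] := by
  induction n generalizing b with
  | zero =>
    have : failAt D 0 = lists A 0 := by
      ext x
      rw [mem_failAt, mem_lists]
      refine and_iff_left_of_imp fun hx => ?_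
      rw [List.length_eq_zero_iff.1 hx]
      rintro ⟨y, hy, hyx⟩
      exact hnil (List.prefix_nil.1 hyx ▸ hy)
    rw [this]
  | succ n ih =>
    obtain ⟨E, hE⟩ := exists_card_failAt_succ_add_card_dictAt_succ s₀ b
    have h1 := hE D hD n
    have h2 := hE ∅ (fun x hx => absurd hx (Set.notMem_empty x)) n
    simp only [failAt_empty, dictAt_empty, Finset.filter_empty, Finset.card_empty, add_zero] at h2
    have h3 : ((failAt D (n + 1)).filter fun x => stringType s₀ x = b).card +
        ((dictAt D (n + 1)).filter fun x => stringType s₀ x = b).card ≡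
        ((failAt D (n + 1)).filter fun x => stringType s₀ x = b).card + 0 [MOD M] :=
      Nat.ModEq.add_left _ (Nat.modEq_zero_iff_dvd.2 (hdvd _ _))
    refine h3.symm.trans ?_
    rw [h1, h2]
    exact Nat.ModEq.sum fun c _ => (ih c).mul_right _

theorem nil_notMem_of_dvd {M : ℕ} (hM : 2 ≤ M) {D : Set (List A)}
    (hdvd : ∀ n b, M ∣ ((dictAt D n).filter fun x => stringType s₀ x = b).card) : [] ∉ D := by
  intro h
  have : (dictAt D 0).filter (fun x => stringType s₀ x = stringType s₀ []) = {[]} := by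
    ext x
    simp only [Finset.mem_filter, mem_dictAt, List.length_eq_zero_iff, Finset.mem_singleton]
    exact ⟨fun h => h.1.1, fun hx => by subst hx; exact ⟨⟨rfl, h⟩, rfl⟩⟩
  have h1 := hdvd 0 (stringType s₀ [])
  rw [this, Finset.card_singleton, Nat.dvd_one] at h1
  omega

variable [Inhabited A] {p : (Fin k → A) → A → ℝ}

theorem mem_typeClassL {x y : List A} :
    y ∈ typeClassL k s₀ x ↔ stringType s₀ y = stringType s₀ x := by
  rw [typeClassL, mem_sfilter, mem_lists, sameTypeL_iff_perm, ← stringType_eq_iff]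
  exact ⟨fun h => h.2.symm, fun h => ⟨length_eq_of_stringType_eq h, h.symm⟩⟩

theorem typeClassL_eq_filter (x : List A) :
    typeClassL k s₀ x = (lists A x.length).filter fun y => stringType s₀ y = stringType s₀ x := by
  ext y
  rw [mem_typeClassL, Finset.mem_filter, mem_lists]
  exact ⟨fun h => ⟨length_eq_of_stringType_eq h, h⟩, fun h => h.2⟩

theorem sfilter_typeClassL (D : Set (List A)) (x : List A) :
    sfilter (fun y => y ∈ D) (typeClassL k s₀ x) =
      (dictAt D x.length).filter fun y => stringType s₀ y = stringType s₀ x := by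
  ext y
  rw [mem_sfilter, typeClassL_eq_filter, Finset.mem_filter, Finset.mem_filter, mem_dictAt,
    mem_lists, and_right_comm]

theorem failIn_typeClassL (D : Set (List A)) (x : List A) :
    failIn D (typeClassL k s₀ x) =
      (failAt D x.length).filter fun y => stringType s₀ y = stringType s₀ x := by
  ext y
  rw [failIn, mem_sfilter, typeClassL_eq_filter, Finset.mem_filter, Finset.mem_filter, mem_failAt,
    mem_lists, and_right_comm]

/-- The dictionary of a universal VFR meets each type class in a multiple of `M` strings. -/
theorem dvd_card_dictAt_of_universal {M : ℕ} (hM : 0 < M) {D : Set (List A)} {ξ : List A → ℕ}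
    (huniv : ∀ p : (Fin k → A) → A → ℝ, IsMarkov k p → PerfectVFR k s₀ p D ξ M) (n : ℕ)
    (b : Multiset ((Fin k → A) × A)) :
    M ∣ ((dictAt D n).filter fun x => stringType s₀ x = b).card := by
  rcases ((dictAt D n).filter fun x => stringType s₀ x = b).eq_empty_or_nonempty with h0 | ⟨y, hy⟩
  · simp [h0]
  obtain ⟨hyD, rfl⟩ := Finset.mem_filter.1 hy
  have hM' : (M : ℝ) ≠ 0 := by positivity
  have hlin := sum_eq_zero_of_forall_isMarkov s₀ (dictAt D n) (fun x hx => (mem_dictAt.1 hx).1)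
    (fun x => (M : ℝ) * (if ξ x = 0 then 1 else 0) - 1) (fun p hp => ?_) (mem_dictAt.1 hyD).1
  · rw [Finset.sum_sub_distrib, ← Finset.mul_sum, Finset.sum_boole,
      Finset.sum_const, nsmul_one, sub_eq_zero] at hlin
    exact ⟨_, by exact_mod_cast hlin.symm⟩
  · have := huniv p hp n ⟨y, hyD⟩ 0 hM
    have hs : sfilter (fun x => ξ x = 0) (dictAt D n) = (dictAt D n).filter fun x => ξ x = 0 := by
      ext x
      rw [mem_sfilter, Finset.mem_filter]
    rw [hs, eq_div_iff hM', Finset.sum_filter] at this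
    simp only [sub_mul, one_mul, Finset.sum_sub_distrib]
    rw [← this, sub_eq_zero, Finset.sum_mul]
    refine Finset.sum_congr rfl fun x _ => ?_
    split_ifs <;> ring

theorem pFail_eq_add (hp : IsMarkov k p) {D : Set (List A)} (hD : PrefixFree D) (n : ℕ) :
    pFail k s₀ p D (n + 1) + ∑ x ∈ dictAt D (n + 1), seqProbL k s₀ p x = pFail k s₀ p D n := by
  rw [pFail, pFail, sum_failAt_succ_add_sum_dictAt_succ hD]
  exact Finset.sum_congr rfl fun y _ => sum_seqProbL_concat hp s₀ y

theorem inLen_eq_sum_pFail (hp : IsMarkov k p) {D : Set (List A)} (hD : PrefixFree D) (N : ℕ) :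
    inLen k s₀ p D N = ∑ n ∈ Finset.range N, pFail k s₀ p D n := by
  induction N with
  | zero => simp [inLen]
  | succ N ih =>
    rw [Finset.sum_range_succ, ← ih, inLen, inLen, Finset.sum_Icc_succ_top (by omega),
      ← Finset.mul_sum, ← pFail_eq_add hp hD N]
    push_cast
    ring

/-- Comparison of failure probabilities from a comparison of the numbers of failures of each
type. -/
theorem pFail_le_and_eq_iff (hp : IsMarkov k p) {D D' : Set (List A)} {n : ℕ}
    (h : ∀ b, ((failAt D n).filter fun x => stringType s₀ x = b).card ≤
      ((failAt D' n).filter fun x => stringType s₀ x = b).card) :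
    pFail k s₀ p D n ≤ pFail k s₀ p D' n ∧
      (pFail k s₀ p D n = pFail k s₀ p D' n →
        ∀ b, ((failAt D n).filter fun x => stringType s₀ x = b).card =
          ((failAt D' n).filter fun x => stringType s₀ x = b).card) := by
  obtain ⟨G, hG⟩ := (Function.factorsThrough_iff _).1
    (show Function.FactorsThrough (seqProbL k s₀ p) (stringType s₀) from
      fun x y hxy => seqProbL_congr (stringType_eq_iff.1 hxy) p)
  have hsum : ∀ D : Set (List A), pFail k s₀ p D n = ∑ b ∈ (lists A n).image (stringType s₀),
      ((failAt D n).filter fun x => stringType s₀ x = b).card • G b := by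
    intro D
    rw [← sum_eq_sum_card_smul fun x hx => (mem_failAt.1 hx).1, pFail, hG]
    rfl
  have hpos : ∀ b ∈ (lists A n).image (stringType s₀), 0 < G b := by
    intro b hb
    obtain ⟨x, -, rfl⟩ := Finset.mem_image.1 hb
    exact (seqProbL_pos hp s₀ x).trans_eq (congrFun hG x)
  have hterm : ∀ b ∈ (lists A n).image (stringType s₀),
      ((failAt D n).filter fun x => stringType s₀ x = b).card • G b ≤
        ((failAt D' n).filter fun x => stringType s₀ x = b).card • G b := fun b hb =>
    nsmul_le_nsmul_left (hpos b hb).le (h b)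
  rw [hsum, hsum]
  refine ⟨Finset.sum_le_sum hterm, fun heq b => ?_⟩
  by_cases hb : b ∈ (lists A n).image (stringType s₀)
  · have := (Finset.sum_eq_sum_iff_of_le hterm).1 heq b hb
    simpa [(hpos b hb).ne'] using this
  · have hempty : ∀ D : Set (List A), (failAt D n).filter (fun x => stringType s₀ x = b) = ∅ := by
      intro D
      refine Finset.filter_eq_empty_iff.2 fun x hx hxb => hb ?_
      exact Finset.mem_image.2 ⟨x, mem_lists.2 (mem_failAt.1 hx).1, hxb⟩
    rw [hempty, hempty]

end Dictionaries

/-- The greedy dictionary `D*` is pointwise optimal: compared to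
the dictionary `D` of any universal VFR it has at most the same failure probability
and expected input length at every truncation level, with strict inequality in
expected input length beyond level `n` as soon as the type profiles differ at
some type class of length `n`. -/
theorem greedy_dictionary_pointwise_optimal {A : Type*} [Fintype A] [DecidableEq A]
    [Inhabited A] (hA : 2 ≤ Fintype.card A) (k : ℕ) (s0 : Fin k → A)
    (M : ℕ) (hM : 2 ≤ M)
    (D : Set (List A)) (hD : CompleteDict D)
    (ξ : List A → ℕ) (hξ : ∀ x ∈ D, ξ x < M)
    (huniv : ∀ p : (Fin k → A) → A → ℝ, IsMarkov k p → PerfectVFR k s0 p D ξ M)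
    (Ds : Set (List A)) (hDs : CompleteDict Ds)
    (hdivs : ∀ n : ℕ, 1 ≤ n → ∀ x ∈ lists A n,
      M ∣ (sfilter (fun y => y ∈ Ds) (typeClassL k s0 x)).card)
    (hfails : ∀ n : ℕ, 1 ≤ n → ∀ x ∈ lists A n,
      (failIn Ds (typeClassL k s0 x)).card = (typeClassL k s0 x).card % M) :
    (∀ N : ℕ, ∀ p : (Fin k → A) → A → ℝ, IsMarkov k p →
      pFail k s0 p Ds N ≤ pFail k s0 p D N ∧ inLen k s0 p Ds N ≤ inLen k s0 p D N) ∧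
    (∀ n : ℕ, 1 ≤ n → ∀ x ∈ lists A n,
      (sfilter (fun y => y ∈ D) (typeClassL k s0 x)).card ≠
        (sfilter (fun y => y ∈ Ds) (typeClassL k s0 x)).card →
      ∀ N : ℕ, n < N → ∀ p : (Fin k → A) → A → ℝ, IsMarkov k p →
        inLen k s0 p Ds N < inLen k s0 p D N) := by
  have hdvd := fun n b => dvd_card_dictAt_of_universal (k := k) (s₀ := s0) (by omega) huniv n b
  have hnil := nil_notMem_of_dvd hM hdvd
  have hle : ∀ n b, ((failAt Ds n).filter fun x => stringType s0 x = b).card ≤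
      ((failAt D n).filter fun x => stringType s0 x = b).card := by
    intro n b
    rcases ((failAt Ds n).filter fun x => stringType s0 x = b).eq_empty_or_nonempty with
      h0 | ⟨x, hx⟩
    · simp [h0]
    obtain ⟨hxD, rfl⟩ := Finset.mem_filter.1 hx
    obtain rfl := (mem_failAt.1 hxD).1
    refine le_trans ?_ (((card_failAt_modEq hD.1 hnil hdvd _ _).symm : _ % M = _ % M).trans_le
      (Nat.mod_le _ M))
    rw [← failIn_typeClassL, ← typeClassL_eq_filter]
    rcases Nat.eq_zero_or_pos x.length with h0 | h0
    · have hsingle : typeClassL k s0 x = {x} := by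
        ext y
        rw [mem_typeClassL, Finset.mem_singleton]
        refine ⟨fun h => ?_, fun h => h ▸ rfl⟩
        have := length_eq_of_stringType_eq h
        rw [List.length_eq_zero_iff.1 h0, List.length_eq_zero_iff.1 (this.trans h0)]
      rw [failIn, hsingle, Finset.card_singleton, Nat.mod_eq_of_lt (by omega)]
      refine Finset.card_le_one.2 fun a ha b hb => ?_
      rw [Finset.mem_singleton.1 (mem_sfilter.1 ha).1, Finset.mem_singleton.1 (mem_sfilter.1 hb).1]
    · exact (hfails _ h0 x (mem_lists.2 rfl)).le
  refine ⟨fun N p hp => ⟨(pFail_le_and_eq_iff hp (hle N)).1, ?_⟩, ?_⟩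
  · rw [inLen_eq_sum_pFail hp hDs.1, inLen_eq_sum_pFail hp hD.1]
    exact Finset.sum_le_sum fun n _ => (pFail_le_and_eq_iff hp (hle n)).1
  · intro n hn x hx hne N hN p hp
    rw [inLen_eq_sum_pFail hp hDs.1, inLen_eq_sum_pFail hp hD.1]
    refine Finset.sum_lt_sum (fun n _ => (pFail_le_and_eq_iff hp (hle n)).1) ?_
    by_contra! hge
    have heq : ∀ m ≤ n, ∀ b, ((failAt Ds m).filter fun x => stringType s0 x = b).card =
        ((failAt D m).filter fun x => stringType s0 x = b).card := fun m hm =>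
      have hm' := pFail_le_and_eq_iff hp (hle m)
      hm'.2 (hm'.1.antisymm (hge m (Finset.mem_range.2 (by omega))))
    obtain ⟨m, rfl⟩ : ∃ m, n = m + 1 := ⟨n - 1, by omega⟩
    obtain ⟨E, hE⟩ := exists_card_failAt_succ_add_card_dictAt_succ s0 (stringType s0 x)
    have h1 := hE D hD.1 m
    have h2 := hE Ds hDs.1 m
    simp only [heq m (by omega)] at h2
    rw [← h1, heq (m + 1) le_rfl, Nat.add_left_cancel_iff] at h2
    apply hne
    rw [sfilter_typeClassL, sfilter_typeClassL, mem_lists.1 hx, h2]
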